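/- In the transportation network setting (B ∈ ℝ^{N×n} with B^T ℂ B positive definite, ℂ = diag(ℂ_e) with ℂ_e > 0, s_e > 0, Φ_D(ε,σ) = Σ_e (ℂ_e^{−1}/(2 s_e²))|σ_e − ℂ_e ε_e|², norm ‖(ε,σ)‖² = Σ_e (ℂ_e|ε_e|² + ℂ_e^{−1}|σ_e|²)), let E := {(ε,σ) ∈ Z : ε = Bu + g for some u ∈ ℝ^n, B^T σ = f} for given f ∈ ℝ^n, g ∈ ℝ^N, and assume E is nonempty. Then there exist constants c' > 0 and b' > 0 such that ‖z‖² ≤ c' Φ_D(z) + b' for all z ∈ E. -/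

import Mathlib

open Matrix

noncomputable section

/-- Squared weighted norm on phase space `Z = ℝ^N × ℝ^N`:
`‖(ε,σ)‖² = Σ_e (ℂ_e |ε_e|² + ℂ_e⁻¹ |σ_e|²)`. -/
def nsq {N : ℕ} (Cc : Fin N → ℝ) (z : (Fin N → ℝ) × (Fin N → ℝ)) : ℝ :=
  ∑ e, (Cc e * (z.1 e) ^ 2 + (Cc e)⁻¹ * (z.2 e) ^ 2)

/-- Material logarithmic potential
`Φ_D(ε,σ) = Σ_e (ℂ_e⁻¹/(2 s_e²)) |σ_e − ℂ_e ε_e|²`. -/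
def PhiD {N : ℕ} (Cc s : Fin N → ℝ) (z : (Fin N → ℝ) × (Fin N → ℝ)) : ℝ :=
  ∑ e, (Cc e)⁻¹ / (2 * (s e) ^ 2) * (z.2 e - Cc e * z.1 e) ^ 2

/-!
STATEMENT 17: on the (nonempty) admissible affine set
`E = {(ε,σ) : ε = Bu + g, Bᵀσ = f}` there are `c', b' > 0` with
`‖z‖² ≤ c' Φ_D(z) + b'` for all `z ∈ E`.
-/

/-- Compatible and equilibrated increments are orthogonal: `Bᵀτ = 0` gives `(Bv) · τ = 0`. -/
lemma sum_mulVec_mul_eq_zero {N n : ℕ} {B : Matrix (Fin N) (Fin n) ℝ} {τ : Fin N → ℝ}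
    (hτ : B.transpose.mulVec τ = 0) (v : Fin n → ℝ) : ∑ e, B.mulVec v e * τ e = 0 := by
  change B.mulVec v ⬝ᵥ τ = 0
  rw [dotProduct_comm, dotProduct_mulVec, ← mulVec_transpose, hτ, zero_dotProduct]

/-- Bound of the energy density by the squared residual `σ - cε`, relative to a base
point `(ε₀, σ₀)`. -/
lemma energy_density_le {c : ℝ} (hc : 0 < c) (ε σ ε₀ σ₀ : ℝ) :
    c * ε ^ 2 + c⁻¹ * σ ^ 2 ≤ 4 * (c⁻¹ * (σ - c * ε) ^ 2) + 4 * (c⁻¹ * (σ₀ - c * ε₀) ^ 2)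
      + 2 * (c * ε₀ ^ 2 + c⁻¹ * σ₀ ^ 2) + 4 * ((ε - ε₀) * (σ - σ₀)) := by
  have key : 4 * (c⁻¹ * (σ - c * ε) ^ 2) + 4 * (c⁻¹ * (σ₀ - c * ε₀) ^ 2)
      + 2 * (c * ε₀ ^ 2 + c⁻¹ * σ₀ ^ 2) + 4 * ((ε - ε₀) * (σ - σ₀))
      - (c * ε ^ 2 + c⁻¹ * σ ^ 2)
      = 2 * (c⁻¹ * ((σ - c * ε) + (σ₀ - c * ε₀)) ^ 2)
        + c * (ε - 2 * ε₀) ^ 2 + c⁻¹ * (σ - 2 * σ₀) ^ 2 := by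
    field_simp
    ring
  have : 0 ≤ 2 * (c⁻¹ * ((σ - c * ε) + (σ₀ - c * ε₀)) ^ 2)
        + c * (ε - 2 * ε₀) ^ 2 + c⁻¹ * (σ - 2 * σ₀) ^ 2 := by positivity
  linarith

/-- The unscaled residual energy is controlled by `PhiD`. -/
lemma sum_residual_le_PhiD {N : ℕ} {Cc s : Fin N → ℝ} (hCc : ∀ e, 0 < Cc e)
    (hs : ∀ e, 0 < s e) (z : (Fin N → ℝ) × (Fin N → ℝ)) :
    ∑ e, (Cc e)⁻¹ * (z.2 e - Cc e * z.1 e) ^ 2 ≤ 2 * (∑ e, s e ^ 2) * PhiD Cc s z := by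
  rw [PhiD, Finset.mul_sum]
  refine Finset.sum_le_sum fun e he => ?_
  have hse := hs e
  have hc := hCc e
  have hle : s e ^ 2 ≤ ∑ i, s i ^ 2 :=
    Finset.single_le_sum (f := fun i => s i ^ 2) (fun i _ => sq_nonneg (s i)) he
  calc (Cc e)⁻¹ * (z.2 e - Cc e * z.1 e) ^ 2
      = 2 * s e ^ 2 * ((Cc e)⁻¹ / (2 * s e ^ 2) * (z.2 e - Cc e * z.1 e) ^ 2) := by
        field_simp
    _ ≤ _ := by gcongr

theorem norm_bound_by_PhiD_on_E
    (N n : ℕ) (B : Matrix (Fin N) (Fin n) ℝ)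
    (Cc : Fin N → ℝ) (hCc : ∀ e, 0 < Cc e)
    (s : Fin N → ℝ) (hs : ∀ e, 0 < s e)
    (hposdef : (B.transpose * Matrix.diagonal Cc * B).PosDef)
    (f : Fin n → ℝ) (g : Fin N → ℝ)
    (hEne : ∃ z : (Fin N → ℝ) × (Fin N → ℝ),
      (∃ u : Fin n → ℝ, z.1 = B.mulVec u + g) ∧ B.transpose.mulVec z.2 = f) :
    ∃ c' : ℝ, 0 < c' ∧ ∃ b' : ℝ, 0 < b' ∧
      ∀ z : (Fin N → ℝ) × (Fin N → ℝ),
        (∃ u : Fin n → ℝ, z.1 = B.mulVec u + g) → B.transpose.mulVec z.2 = f →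
        nsq Cc z ≤ c' * PhiD Cc s z + b' := by
  obtain ⟨z₀, ⟨u₀, hu₀⟩, hσ₀⟩ := hEne
  have hS : 0 ≤ ∑ e, s e ^ 2 := Finset.sum_nonneg fun e _ => sq_nonneg (s e)
  have hR : 0 ≤ ∑ e, (Cc e)⁻¹ * (z₀.2 e - Cc e * z₀.1 e) ^ 2 :=
    Finset.sum_nonneg fun e _ => mul_nonneg (inv_pos.2 (hCc e)).le (sq_nonneg _)
  have hnsq : 0 ≤ nsq Cc z₀ := Finset.sum_nonneg fun e _ => by
    have := hCc e
    positivity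
  refine ⟨8 * (∑ e, s e ^ 2) + 1, by positivity,
    4 * (∑ e, (Cc e)⁻¹ * (z₀.2 e - Cc e * z₀.1 e) ^ 2) + 2 * nsq Cc z₀ + 1, by positivity, ?_⟩
  rintro z ⟨u, hu⟩ hσ
  have horth : ∑ e, (z.1 e - z₀.1 e) * (z.2 e - z₀.2 e) = 0 := by
    have h := sum_mulVec_mul_eq_zero (B := B) (τ := z.2 - z₀.2)
      (by rw [mulVec_sub, hσ, hσ₀, sub_self]) (u - u₀)
    simpa [hu, hu₀, mulVec_sub] using h
  have hbound := Finset.sum_le_sum fun e (_ : e ∈ Finset.univ) =>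
    energy_density_le (hCc e) (z.1 e) (z.2 e) (z₀.1 e) (z₀.2 e)
  rw [Finset.sum_add_distrib (f := fun e => _ + _ + _), Finset.sum_add_distrib (f := fun e => _ + _),
    Finset.sum_add_distrib (f := fun e => 4 * _), ← Finset.mul_sum, ← Finset.mul_sum,
    ← Finset.mul_sum, ← Finset.mul_sum, horth] at hbound
  change nsq Cc z ≤ _ + 2 * nsq Cc z₀ + _ at hbound
  have hres := sum_residual_le_PhiD hCc hs z
  have hPhi : 0 ≤ PhiD Cc s z := Finset.sum_nonneg fun e _ => by
    have := hCc e
    have := hs e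
    positivity
  linarith
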